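/- Let K be a field of characteristic zero and let q ∈ K with q ≠ 0. Let M₊(q) be the 6×6 matrix over K with rows (0, 4q, 0, 0, 32q², 0), (1, 0, 6q, 2q, 0, 16q²), (0, 1, 0, 0, 6q, 0), (0, 2, 0, 0, 4q, 0), (0, 0, 1, 1, 0, 2q), (0, 0, 0, 0, 2, 0). Then the generalized eigenspace of 2·M₊(q) for the eigenvalue 0, i.e. the kernel of (2·M₊(q))⁶, has dimension 2 over K. -/

import Mathlib

def Mplus (K : Type*) [Field K] (q : K) : Matrix (Fin 6) (Fin 6) K :=
  !![0, 4*q, 0, 0, 32*q^2, 0;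
     1, 0, 6*q, 2*q, 0, 16*q^2;
     0, 1, 0, 0, 6*q, 0;
     0, 2, 0, 0, 4*q, 0;
     0, 0, 1, 1, 0, 2*q;
     0, 0, 0, 0, 2, 0]

theorem Mplus_mulVec_zero_iff (K : Type*) [Field K] [CharZero K] (q : K) (v : Fin 6 → K) :
    (Mplus K q).mulVec v = 0 ↔
      (v 1 = 0 ∧ v 4 = 0 ∧ v 2 = - v 3 - 2*q*v 5 ∧ v 0 = 4*q*v 3 - 4*q^2*v 5) := by
  constructor
  · intro h
    have h1 := congrFun h 1
    have h2 := congrFun h 2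
    have h4 := congrFun h 4
    have h5 := congrFun h 5
    simp [Mplus, Matrix.mulVec, dotProduct, Fin.sum_univ_succ] at h1 h2 h4 h5
    refine ⟨by linear_combination h2 - 6*q*h5, h5, by linear_combination h4,
      by linear_combination h1 - 6*q*h4⟩
  · rintro ⟨h1, h4, h2, h0⟩
    ext i
    fin_cases i <;> simp [Mplus, Matrix.mulVec, dotProduct, Fin.sum_univ_succ] <;>
      simp [h1, h4, h2, h0] <;> ring

theorem Mplus_sq (K : Type*) [Field K] [CharZero K] (q : K) (hq : q ≠ 0) (v : Fin 6 → K)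
    (h : (Mplus K q).mulVec ((Mplus K q).mulVec v) = 0) : (Mplus K q).mulVec v = 0 := by
  have h' := (Mplus_mulVec_zero_iff K q _).1 h
  obtain ⟨a1, a4, a2, a0⟩ := h'
  have e0 : (Mplus K q).mulVec v 0 = 4*q*v 1 + 32*q^2*v 4 := by
    simp [Mplus, Matrix.mulVec, dotProduct, Fin.sum_univ_succ]
  have e2 : (Mplus K q).mulVec v 2 = v 1 + 6*q*v 4 := by
    simp [Mplus, Matrix.mulVec, dotProduct, Fin.sum_univ_succ]
  have e3 : (Mplus K q).mulVec v 3 = 2*v 1 + 4*q*v 4 := by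
    simp [Mplus, Matrix.mulVec, dotProduct, Fin.sum_univ_succ]
  have e5 : (Mplus K q).mulVec v 5 = 2*v 4 := by
    simp [Mplus, Matrix.mulVec, dotProduct, Fin.sum_univ_succ]
  have b2 := a2
  have b0 := a0
  rw [e2, e3, e5] at b2
  rw [e0, e3, e5] at b0
  have h4 : v 4 = 0 := by
    have : (128 * q^2) * v 4 = 0 := by linear_combination 4*q*b2 + 3*b0
    rcases mul_eq_zero.1 this with h | h
    · exact absurd h (mul_ne_zero (by norm_num) (pow_ne_zero _ hq))
    · exact h
  have h1 : v 1 = 0 := by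
    have : (3:K) * v 1 = 0 := by linear_combination b2 - 14*q*h4
    exact (mul_eq_zero.1 this).resolve_left (by norm_num)
  ext i
  fin_cases i
  · simpa [h1, h4] using e0
  · exact a1
  · simpa [h1, h4] using e2
  · simpa [h1, h4] using e3
  · exact a4
  · simpa [h1, h4] using e5

theorem Mplus_pow (K : Type*) [Field K] [CharZero K] (q : K) (hq : q ≠ 0) (n : ℕ) :
    ∀ v : Fin 6 → K, ((Mplus K q)^(n+1)).mulVec v = 0 ↔ (Mplus K q).mulVec v = 0 := by
  induction n with
  | zero => intro v; simp
  | succ n ih =>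
    intro v
    rw [pow_succ, ← Matrix.mulVec_mulVec, ih]
    exact ⟨Mplus_sq K q hq v, fun h => by rw [h, Matrix.mulVec_zero]⟩

/-- Parametrization of the kernel. -/
def kerParam (K : Type*) [Field K] (q : K) : (Fin 2 → K) →ₗ[K] (Fin 6 → K) :=
  Matrix.mulVecLin !![4*q, -4*q^2; 0, 0; -1, -2*q; 1, 0; 0, 0; 0, 1]

theorem generalized_zero_eigenspace_Mplus (K : Type*) [Field K] [CharZero K]
    (q : K) (hq : q ≠ 0) :
    Module.finrank K ↥(LinearMap.ker (Matrix.mulVecLin (((2 : K) • Mplus K q) ^ 6))) = 2 := by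
  have hk : LinearMap.ker (Matrix.mulVecLin (((2 : K) • Mplus K q) ^ 6))
      = LinearMap.range (kerParam K q) := by
    ext v
    rw [LinearMap.mem_ker, Matrix.mulVecLin_apply, smul_pow, Matrix.smul_mulVec,
      smul_eq_zero_iff_right (pow_ne_zero _ two_ne_zero), Mplus_pow K q hq 5,
      Mplus_mulVec_zero_iff, LinearMap.mem_range]
    constructor
    · rintro ⟨h1, h4, h2, h0⟩
      refine ⟨![v 3, v 5], ?_⟩
      ext i
      fin_cases i <;> simp [kerParam, Matrix.mulVec, dotProduct, h1, h4, h2, h0] <;> ring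
    · rintro ⟨w, rfl⟩
      simp [kerParam, Matrix.mulVec, dotProduct]
      constructor <;> ring
  have hi : Function.Injective (kerParam K q) := by
    intro a b h
    have h3 := congrFun h 3
    have h5 := congrFun h 5
    simp [kerParam, Matrix.mulVec, dotProduct] at h3 h5
    ext i
    fin_cases i
    · exact h3
    · exact h5
  rw [hk, LinearMap.finrank_range_of_inj hi]
  simp
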